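/- arXiv:1809.06296 — 7 statements merged into one kernel-verified Lean document; each statement's English description precedes it below -/
import Mathlib

section
/- Let $k>0$, let $a<b$ be real numbers, and let $U:(a,b)\to \mathrm{Mat}_{n\times n}(\mathbb{R})$ be a differentiable matrix-valued function such that $U(t)$ is symmetric for every $t\in(a,b)$ and $U$ solves the Riccati equation $U'(t)+U(t)^2+R(t)=0$ on $(a,b)$, where $R:(a,b)\to \mathrm{Mat}_{n\times n}(\mathbb{R})$ is such that $R(t)$ is symmetric and $R(t)+k^2\,\mathrm{Id}$ is positive semidefinite for every $t\in(a,b)$. Then for every $t\in(a,b)$ and every $x\in\mathbb{R}^n$, $|\langle U(t)x,x\rangle| \le k\,\max\big(|\coth(k(t-a))|,\; |\coth(k(t-b))|\big)\,\|x\|^2$. -/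
open Matrix Set

/-- The hyperbolic cotangent. -/
noncomputable def coth (s : ℝ) : ℝ := Real.cosh s / Real.sinh s

/-- A scalar subsolution of the Riccati equation `q' + q² = k²` on `(a,b)` lies below
`k coth(k(t-a))`. -/
theorem le_coth_of_deriv_le {k a b : ℝ} (hk : 0 < k) {q q' : ℝ → ℝ}
    (hq : ∀ t ∈ Ioo a b, HasDerivAt q (q' t) t)
    (hle : ∀ t ∈ Ioo a b, q' t ≤ k ^ 2 - q t ^ 2) {t : ℝ} (ht : t ∈ Ioo a b) :
    q t ≤ k * coth (k * (t - a)) := by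
  have hqc : ContinuousOn q (Ioo a b) := fun s hs => (hq s hs).continuousAt.continuousWithinAt
  have key : ∀ c ∈ Ioo a t,
      q t * Real.sinh (k * (t - c)) - k * Real.cosh (k * (t - c)) ≤ 0 := by
    intro c hc
    set f : ℝ → ℝ := fun s => q s * Real.sinh (k * (s - c)) - k * Real.cosh (k * (s - c)) with hf
    set Q : ℝ → ℝ := fun s => ∫ r in c..s, q r
    have hsub : Icc c t ⊆ Ioo a b := fun s hs => ⟨hc.1.trans_le hs.1, hs.2.trans_lt ht.2⟩
    have hQ : ∀ s ∈ Icc c t, HasDerivAt Q (q s) s := by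
      intro s hs
      refine intervalIntegral.integral_hasDerivAt_right ?_
        (hqc.stronglyMeasurableAtFilter isOpen_Ioo s (hsub hs)) (hq s (hsub hs)).continuousAt
      refine (hqc.mono ?_).intervalIntegrable
      rw [uIcc_of_le hs.1]
      exact (Icc_subset_Icc_right hs.2).trans hsub
    have hlin : ∀ s, HasDerivAt (fun s => k * (s - c)) k s := fun s => by
      simpa using ((hasDerivAt_id s).sub_const c).const_mul k
    have hfd : ∀ s ∈ Icc c t, HasDerivAt f
        (q' s * Real.sinh (k * (s - c)) + q s * (Real.cosh (k * (s - c)) * k)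
          - k * (Real.sinh (k * (s - c)) * k)) s := fun s hs =>
      ((hq s (hsub hs)).mul (hlin s).sinh).sub ((hlin s).cosh.const_mul k)
    have hFd := fun s hs => (hfd s hs).mul (hQ s hs).exp
    have hanti : AntitoneOn (f * fun s => Real.exp (Q s)) (Icc c t) := by
      refine antitoneOn_of_hasDerivWithinAt_nonpos (convex_Icc c t)
        (fun s hs => (hFd s hs).continuousAt.continuousWithinAt)
        (fun s hs => (hFd s (interior_subset hs)).hasDerivWithinAt) ?_
      intro s hs
      have hs' := interior_subset hs
      have hsinh : 0 ≤ Real.sinh (k * (s - c)) :=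
        Real.sinh_nonneg_iff.2 (mul_nonneg hk.le (sub_nonneg.2 hs'.1))
      have hmul := mul_le_mul_of_nonneg_right (hle s (hsub hs')) hsinh
      have hE := Real.exp_pos (Q s)
      have hnonpos : q' s * Real.sinh (k * (s - c)) + q s * (Real.cosh (k * (s - c)) * k)
          - k * (Real.sinh (k * (s - c)) * k) + f s * q s ≤ 0 := by
        simp only [hf]
        linarith
      have := mul_nonpos_of_nonpos_of_nonneg hnonpos hE.le
      linarith
    have hct := hanti (left_mem_Icc.2 hc.2.le) (right_mem_Icc.2 hc.2.le) hc.2.le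
    have hfc : f c = -k := by simp [hf]
    simp only [Pi.mul_apply, hfc] at hct
    have hneg : f t * Real.exp (Q t) ≤ 0 :=
      hct.trans (mul_nonpos_of_nonpos_of_nonneg (by linarith) (Real.exp_pos _).le)
    exact nonpos_of_mul_nonpos_left hneg (Real.exp_pos _)
  have hlim : q t * Real.sinh (k * (t - a)) - k * Real.cosh (k * (t - a)) ≤ 0 := by
    have hcont : Continuous fun c =>
        q t * Real.sinh (k * (t - c)) - k * Real.cosh (k * (t - c)) := by fun_prop
    have hcl := closure_minimal (s := Ioo a t) key (isClosed_le hcont continuous_const)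
    rw [closure_Ioo ht.1.ne] at hcl
    exact hcl (left_mem_Icc.2 ht.1.le)
  have hsinh : 0 < Real.sinh (k * (t - a)) :=
    Real.sinh_pos_iff.2 (mul_pos hk (sub_pos.2 ht.1))
  rw [coth, ← mul_div_assoc, le_div_iff₀ hsinh]
  linarith

/-- A scalar subsolution of the Riccati equation `q' + q² = k²` on `(a,b)` lies above
`k coth(k(t-b))`. -/
theorem coth_le_of_deriv_le {k a b : ℝ} (hk : 0 < k) {q q' : ℝ → ℝ}
    (hq : ∀ t ∈ Ioo a b, HasDerivAt q (q' t) t)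
    (hle : ∀ t ∈ Ioo a b, q' t ≤ k ^ 2 - q t ^ 2) {t : ℝ} (ht : t ∈ Ioo a b) :
    k * coth (k * (t - b)) ≤ q t := by
  have hmem : ∀ s ∈ Ioo (-b) (-a), -s ∈ Ioo a b := fun s hs =>
    ⟨by linarith [hs.2], by linarith [hs.1]⟩
  have h := le_coth_of_deriv_le (a := -b) (b := -a) (t := -t) hk
    (q := fun s => -q (-s)) (q' := fun s => q' (-s))
    (fun s hs => by
      have := ((hq (-s) (hmem s hs)).scomp s (hasDerivAt_neg s)).fun_neg
      simpa [Function.comp_def] using this)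
    (fun s hs => by simpa using hle (-s) (hmem s hs))
    ⟨by linarith [ht.2], by linarith [ht.1]⟩
  have harg : k * (-t - -b) = -(k * (t - b)) := by ring
  simp only [neg_neg, harg, coth, Real.cosh_neg, Real.sinh_neg, div_neg, mul_neg] at h
  rw [coth]
  linarith

/-- The quadratic form of a solution of the matrix Riccati inequality `U' + U² ≤ k²` satisfies
the corresponding scalar inequality. -/
theorem dotProduct_mul_le_of_riccati {n : ℕ} {k : ℝ} {U U' R : Matrix (Fin n) (Fin n) ℝ}
    (hU : Uᵀ = U) (hric : U' + U ^ 2 + R = 0) (x : Fin n → ℝ)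
    (hR : 0 ≤ ((R + (k ^ 2) • (1 : Matrix (Fin n) (Fin n) ℝ)) *ᵥ x) ⬝ᵥ x) :
    ((U' *ᵥ x) ⬝ᵥ x) * (x ⬝ᵥ x) ≤ k ^ 2 * (x ⬝ᵥ x) ^ 2 - ((U *ᵥ x) ⬝ᵥ x) ^ 2 := by
  have hsq : ((U ^ 2) *ᵥ x) ⬝ᵥ x = (U *ᵥ x) ⬝ᵥ (U *ᵥ x) := by
    rw [pow_two, ← mulVec_mulVec, dotProduct_comm, dotProduct_mulVec, ← mulVec_transpose, hU]
  have hsum : ((U' + U ^ 2 + R) *ᵥ x) ⬝ᵥ x = 0 := by simp [hric]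
  have hcs : ((U *ᵥ x) ⬝ᵥ x) ^ 2 ≤ ((U *ᵥ x) ⬝ᵥ (U *ᵥ x)) * (x ⬝ᵥ x) := by
    simpa [dotProduct, pow_two] using
      Finset.sum_mul_sq_le_sq_mul_sq Finset.univ (U *ᵥ x) x
  have hx : 0 ≤ x ⬝ᵥ x := by simpa using dotProduct_star_self_nonneg x
  simp only [add_mulVec, add_dotProduct, hsq, smul_mulVec, one_mulVec, smul_dotProduct,
    smul_eq_mul] at hsum hR
  have hU' : (U' *ᵥ x) ⬝ᵥ x ≤ k ^ 2 * (x ⬝ᵥ x) - (U *ᵥ x) ⬝ᵥ (U *ᵥ x) := by linarith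
  have := mul_le_mul_of_nonneg_right hU' hx
  linarith

/-- Lemma A.2 (Riccati comparison): a symmetric solution of the Riccati equation
`U' + U² + R = 0` on `(a,b)` with `R ≥ -k² Id` satisfies
`|⟨U(t)x,x⟩| ≤ k max(|coth(k(t-a))|, |coth(k(t-b))|) ‖x‖²`. -/
theorem riccati_coth_bound {n : ℕ} (k a b : ℝ) (hk : 0 < k) (hab : a < b)
    (U U' R : ℝ → Matrix (Fin n) (Fin n) ℝ)
    (hderiv : ∀ t ∈ Ioo a b, ∀ i j, HasDerivAt (fun s => U s i j) (U' t i j) t)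
    (hUsymm : ∀ t ∈ Ioo a b, (U t)ᵀ = U t)
    (hric : ∀ t ∈ Ioo a b, U' t + U t ^ 2 + R t = 0)
    (hRsymm : ∀ t ∈ Ioo a b, (R t)ᵀ = R t)
    (hRpsd : ∀ t ∈ Ioo a b, ∀ x : Fin n → ℝ,
      0 ≤ ((R t + (k ^ 2) • (1 : Matrix (Fin n) (Fin n) ℝ)) *ᵥ x) ⬝ᵥ x) :
    ∀ t ∈ Ioo a b, ∀ x : Fin n → ℝ,
      |(U t *ᵥ x) ⬝ᵥ x| ≤
        k * max |coth (k * (t - a))| |coth (k * (t - b))| * (x ⬝ᵥ x) := by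
  intro t ht x
  rcases eq_or_ne x 0 with rfl | hx
  · simp
  have hm : 0 < x ⬝ᵥ x := by
    simpa using dotProduct_star_self_pos_iff.2 hx
  have hq : ∀ s ∈ Ioo a b, HasDerivAt (fun s => ((U s *ᵥ x) ⬝ᵥ x) / (x ⬝ᵥ x))
      (((U' s *ᵥ x) ⬝ᵥ x) / (x ⬝ᵥ x)) s := by
    intro s hs
    refine HasDerivAt.div_const ?_ _
    simp only [dotProduct, mulVec]
    exact HasDerivAt.fun_sum fun i _ =>
      (HasDerivAt.fun_sum fun j _ => (hderiv s hs i j).mul_const (x j)).mul_const (x i)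
  have hle : ∀ s ∈ Ioo a b, ((U' s *ᵥ x) ⬝ᵥ x) / (x ⬝ᵥ x) ≤
      k ^ 2 - (((U s *ᵥ x) ⬝ᵥ x) / (x ⬝ᵥ x)) ^ 2 := by
    intro s hs
    have h := dotProduct_mul_le_of_riccati (hUsymm s hs) (hric s hs) x (hRpsd s hs x)
    rw [div_pow, div_le_iff₀ hm]
    have hdiv := (le_div_iff₀ hm).2 h
    refine hdiv.trans_eq ?_
    field_simp
  have hup := le_coth_of_deriv_le hk hq hle ht
  have hlow := coth_le_of_deriv_le hk hq hle ht
  have habs := abs_div ((U t *ᵥ x) ⬝ᵥ x) (x ⬝ᵥ x)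
  rw [abs_of_pos hm] at habs
  rw [← div_le_iff₀ hm, ← habs, abs_le]
  constructor
  · refine le_trans ?_ hlow
    rw [← mul_neg]
    refine mul_le_mul_of_nonneg_left ?_ hk.le
    exact (neg_le_neg (le_max_right _ _)).trans (neg_abs_le _)
  · refine hup.trans (mul_le_mul_of_nonneg_left ?_ hk.le)
    exact (le_abs_self _).trans (le_max_left _ _)
end

section
/- Let $k>0$, let $a<b$ be real numbers, and let $U:(a,b)\to \mathrm{Mat}_{n\times n}(\mathbb{R})$ be a differentiable matrix-valued function such that $U(t)$ is symmetric for every $t\in(a,b)$ and $U$ solves the Riccati equation $U'(t)+U(t)^2+R(t)=0$ on $(a,b)$, where $R(t)$ is symmetric and $R(t)+k^2\,\mathrm{Id}$ is positive semidefinite for every $t\in(a,b)$. Then for every $t\in(a,b)$ and every $x\in\mathbb{R}^n$, $\langle U(t)x,x\rangle \le k\coth(k(t-a))\,\|x\|^2$. -/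
open Matrix Set

/-- A scalar subsolution of `f' = k² - f²` on an open interval starting left of `c` lies below
`k coth (k (t - c))`, in the form with the denominator cleared. -/
theorem mul_sinh_le_of_deriv_le_sq_sub_sq {k a b c t : ℝ} (hk : 0 < k) (hac : a < c) (hct : c < t)
    (htb : t < b) {f f' : ℝ → ℝ} (hf : ∀ s ∈ Ioo a b, HasDerivAt f (f' s) s)
    (hle : ∀ s ∈ Ioo a b, f' s ≤ k ^ 2 - f s ^ 2) :
    f t * Real.sinh (k * (t - c)) ≤ k * Real.cosh (k * (t - c)) := by
  have hsub : Icc c t ⊆ Ioo a b := fun s hs => ⟨hac.trans_le hs.1, hs.2.trans_lt htb⟩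
  have hcont : ContinuousOn f (Ioo a b) := fun s hs => (hf s hs).continuousAt.continuousWithinAt
  have hF : ∀ s ∈ Icc c t, HasDerivAt (fun u => ∫ v in c..u, f v) (f s) s := by
    intro s hs
    refine intervalIntegral.integral_hasDerivAt_right ?_ ?_ (hf s (hsub hs)).continuousAt
    · refine (hcont.mono ?_).intervalIntegrable
      rw [uIcc_of_le hs.1]
      exact (Icc_subset_Icc_right hs.2).trans hsub
    · exact hcont.stronglyMeasurableAtFilter isOpen_Ioo s (hsub hs)
  have hw : ∀ s ∈ Icc c t, HasDerivAt
      (fun u => (f u * Real.sinh (k * (u - c)) - k * Real.cosh (k * (u - c))) *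
        Real.exp (∫ v in c..u, f v))
      ((f' s + f s ^ 2 - k ^ 2) * Real.sinh (k * (s - c)) * Real.exp (∫ v in c..s, f v)) s := by
    intro s hs
    have hlin : HasDerivAt (fun u => k * (u - c)) k s := by
      simpa using ((hasDerivAt_id s).sub_const c).const_mul k
    refine ((((hf s (hsub hs)).mul hlin.sinh).sub (hlin.cosh.const_mul k)).mul
      (hF s hs).exp).congr_deriv ?_
    simp only [Pi.mul_apply, Pi.sub_apply]
    ring
  have hanti := antitoneOn_of_deriv_nonpos (convex_Icc c t)
    (fun s hs => (hw s hs).continuousAt.continuousWithinAt)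
    (fun s hs => (hw s (interior_subset hs)).differentiableAt.differentiableWithinAt)
    (fun s hs => by
      have hs' := interior_subset hs
      rw [(hw s hs').deriv]
      have hsinh : 0 ≤ Real.sinh (k * (s - c)) :=
        Real.sinh_nonneg_iff.2 (mul_nonneg hk.le (sub_nonneg.2 hs'.1))
      exact mul_nonpos_of_nonpos_of_nonneg (mul_nonpos_of_nonpos_of_nonneg
        (by linarith [hle s (hsub hs')]) hsinh) (Real.exp_pos _).le)
  have hend := hanti (left_mem_Icc.2 hct.le) (right_mem_Icc.2 hct.le) hct.le
  simp only [sub_self, mul_zero, Real.sinh_zero, Real.cosh_zero, intervalIntegral.integral_same,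
    Real.exp_zero] at hend
  exact sub_nonpos.1 (nonpos_of_mul_nonpos_left (by linarith) (Real.exp_pos _))

/-- Scalar Riccati comparison: if `f' ≤ k² - f²` on `(a,b)` then `f t ≤ k coth (k (t - a))`. -/
theorem le_mul_coth_of_deriv_le_sq_sub_sq {k a b t : ℝ} (hk : 0 < k) (ht : t ∈ Ioo a b)
    {f f' : ℝ → ℝ} (hf : ∀ s ∈ Ioo a b, HasDerivAt f (f' s) s)
    (hle : ∀ s ∈ Ioo a b, f' s ≤ k ^ 2 - f s ^ 2) :
    f t ≤ k * coth (k * (t - a)) := by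
  have hsinh : 0 < Real.sinh (k * (t - a)) :=
    Real.sinh_pos_iff.2 (mul_pos hk (sub_pos.2 ht.1))
  rw [coth, ← mul_div_assoc, le_div_iff₀ hsinh]
  have hl : Continuous fun c => f t * Real.sinh (k * (t - c)) := by fun_prop
  have hr : Continuous fun c => k * Real.cosh (k * (t - c)) := by fun_prop
  refine le_of_tendsto_of_tendsto (b := nhdsWithin a (Ioi a)) hl.continuousWithinAt.tendsto
    hr.continuousWithinAt.tendsto ?_
  filter_upwards [Ioo_mem_nhdsGT ht.1] with c hc
  exact mul_sinh_le_of_deriv_le_sq_sub_sq hk hc.1 hc.2 ht.2 hf hle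

/-- The quadratic form of a differentiable matrix-valued function is differentiable. -/
theorem hasDerivAt_mulVec_dotProduct {n : Type*} [Fintype n] {U : ℝ → Matrix n n ℝ}
    {U' : Matrix n n ℝ} {t : ℝ} (h : ∀ i j, HasDerivAt (fun s => U s i j) (U' i j) t)
    (x : n → ℝ) : HasDerivAt (fun s => (U s *ᵥ x) ⬝ᵥ x) ((U' *ᵥ x) ⬝ᵥ x) t := by
  simp only [mulVec, dotProduct]
  exact HasDerivAt.fun_sum fun i _ =>
    (HasDerivAt.fun_sum fun j _ => (h i j).mul_const (x j)).mul_const (x i)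

/-- For symmetric `A`, Cauchy–Schwarz bounds the square of the quadratic form of `A`
by the quadratic form of `A²`. -/
theorem sq_mulVec_dotProduct_le {n : Type*} [Fintype n] [DecidableEq n] {A : Matrix n n ℝ}
    (hA : Aᵀ = A) (x : n → ℝ) :
    ((A *ᵥ x) ⬝ᵥ x) ^ 2 ≤ ((A ^ 2 *ᵥ x) ⬝ᵥ x) * (x ⬝ᵥ x) := by
  have h : (A ^ 2 *ᵥ x) ⬝ᵥ x = (A *ᵥ x) ⬝ᵥ (A *ᵥ x) := by
    rw [dotProduct_mulVec, ← mulVec_transpose, hA, mulVec_mulVec, pow_two]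
  rw [h]
  simpa only [dotProduct, pow_two] using
    Finset.sum_mul_sq_le_sq_mul_sq Finset.univ (A *ᵥ x) x

/-- Upper Riccati comparison bound: a symmetric solution of `U' + U² + R = 0` on `(a,b)`
with `R ≥ -k² Id` satisfies `⟨U(t)x,x⟩ ≤ k coth(k(t-a)) ‖x‖²`. -/
theorem riccati_coth_upper_bound {n : ℕ} (k a b : ℝ) (hk : 0 < k) (hab : a < b)
    (U U' R : ℝ → Matrix (Fin n) (Fin n) ℝ)
    (hderiv : ∀ t ∈ Ioo a b, ∀ i j, HasDerivAt (fun s => U s i j) (U' t i j) t)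
    (hUsymm : ∀ t ∈ Ioo a b, (U t)ᵀ = U t)
    (hric : ∀ t ∈ Ioo a b, U' t + U t ^ 2 + R t = 0)
    (hRsymm : ∀ t ∈ Ioo a b, (R t)ᵀ = R t)
    (hRpsd : ∀ t ∈ Ioo a b, ∀ x : Fin n → ℝ,
      0 ≤ ((R t + (k ^ 2) • (1 : Matrix (Fin n) (Fin n) ℝ)) *ᵥ x) ⬝ᵥ x) :
    ∀ t ∈ Ioo a b, ∀ x : Fin n → ℝ,
      (U t *ᵥ x) ⬝ᵥ x ≤ k * coth (k * (t - a)) * (x ⬝ᵥ x) := by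
  intro t ht x
  rcases eq_or_ne x 0 with rfl | hx
  · simp
  have hN : 0 < x ⬝ᵥ x :=
    lt_of_le_of_ne (Finset.sum_nonneg fun i _ => mul_self_nonneg (x i))
      fun h => hx (dotProduct_self_eq_zero.1 h.symm)
  rw [← div_le_iff₀ hN]
  refine le_mul_coth_of_deriv_le_sq_sub_sq (f := fun s => (U s *ᵥ x) ⬝ᵥ x / (x ⬝ᵥ x)) hk ht
    (fun s hs => (hasDerivAt_mulVec_dotProduct (hderiv s hs) x).div_const _) fun s hs => ?_
  have hcs := sq_mulVec_dotProduct_le (hUsymm s hs) x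
  have hR := hRpsd s hs x
  have hsum := congrArg (fun A => (A *ᵥ x) ⬝ᵥ x) (hric s hs)
  simp only [add_mulVec, add_dotProduct, zero_mulVec, zero_dotProduct, smul_mulVec, one_mulVec,
    smul_dotProduct, smul_eq_mul] at hR hsum
  rw [div_pow, le_sub_iff_add_le, div_add_div _ _ hN.ne' (pow_pos hN 2).ne',
    div_le_iff₀ (mul_pos hN (pow_pos hN 2))]
  nlinarith [mul_le_mul_of_nonneg_left hcs hN.le, mul_nonneg hR (sq_nonneg (x ⬝ᵥ x))]
end

section
/- Let $k>0$, let $a<b$ be real numbers, and let $U:(a,b)\to \mathrm{Mat}_{n\times n}(\mathbb{R})$ be a differentiable matrix-valued function such that $U(t)$ is symmetric for every $t\in(a,b)$ and $U$ solves the Riccati equation $U'(t)+U(t)^2+R(t)=0$ on $(a,b)$, where $R(t)$ is symmetric and $R(t)+k^2\,\mathrm{Id}$ is positive semidefinite for every $t\in(a,b)$. Then for every $t\in(a,b)$ and every $x\in\mathbb{R}^n$, $\langle U(t)x,x\rangle \ge k\coth(k(t-b))\,\|x\|^2$ (note that $\coth(k(t-b))<0$ since $t<b$). -/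
open Matrix Set

/-- Scalar comparison: a solution of `u' ≤ k² - u²` on `(a,b)` satisfies
`u t ≥ k coth (k (t - b))`. -/
theorem coth_le_of_deriv_le_sq_sub_sq {k a b : ℝ} (hk : 0 < k) {u u' : ℝ → ℝ}
    (hu : ∀ t ∈ Ioo a b, HasDerivAt u (u' t) t)
    (hle : ∀ t ∈ Ioo a b, u' t ≤ k ^ 2 - u t ^ 2) {t : ℝ} (ht : t ∈ Ioo a b) :
    k * coth (k * (t - b)) ≤ u t := by
  by_contra! h
  have hsinh : Real.sinh (k * (t - b)) < 0 :=
    Real.sinh_neg_iff.2 (mul_neg_of_pos_of_neg hk (by linarith [ht.2]))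
  have hpos : 0 < u t * Real.sinh (k * (t - b)) - k * Real.cosh (k * (t - b)) := by
    have h1 := mul_lt_mul_of_neg_right h hsinh
    rw [coth, mul_assoc, div_mul_cancel₀ _ hsinh.ne] at h1
    linarith
  -- The strict inequality at `t` persists for a slightly larger rate and an earlier pole.
  obtain ⟨ε, hεpos, hε, hεt⟩ : ∃ ε : ℝ,
      0 < u t * Real.sinh ((k + ε) * (t - (b - ε)))
        - (k + ε) * Real.cosh ((k + ε) * (t - (b - ε))) ∧ 0 < ε ∧ ε < b - t := by
    have hcont : Continuous fun ε : ℝ => u t * Real.sinh ((k + ε) * (t - (b - ε)))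
        - (k + ε) * Real.cosh ((k + ε) * (t - (b - ε))) := by fun_prop
    have hev := (hcont.tendsto 0).eventually_const_lt (u := 0) (by simpa using hpos)
    have hIoo := Ioo_mem_nhdsGT (sub_pos.2 ht.2)
    obtain ⟨ε, h1, h2⟩ := ((hev.filter_mono nhdsWithin_le_nhds).and hIoo).exists
    exact ⟨ε, h1, h2.1, h2.2⟩
  set l := k + ε with hl
  set c := b - ε with hc
  have hlpos : 0 < l := by linarith
  have hsub : ∀ s ∈ Icc t c, s ∈ Ioo a b := fun s hs =>
    ⟨ht.1.trans_le hs.1, by linarith [hs.2]⟩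
  have hderiv : ∀ s ∈ Icc t c, HasDerivAt
      (fun s => l * Real.cosh (l * (s - c)) - u s * Real.sinh (l * (s - c)))
      (l * (Real.sinh (l * (s - c)) * l)
        - (u' s * Real.sinh (l * (s - c)) + u s * (Real.cosh (l * (s - c)) * l))) s := by
    intro s hs
    have hlin : HasDerivAt (fun s => l * (s - c)) l s := by
      simpa using ((hasDerivAt_id s).sub_const c).const_mul l
    exact (hlin.cosh.const_mul l).sub ((hu s (hsub s hs)).mul hlin.sinh)
  have key := image_le_of_deriv_right_lt_deriv_boundary (B := fun _ => (0 : ℝ))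
    (B' := fun _ => 0)
    (fun s hs => (hderiv s hs).continuousAt.continuousWithinAt)
    (fun s hs => (hderiv s (Ico_subset_Icc_self hs)).hasDerivWithinAt)
    (by linarith) (fun s => hasDerivAt_const s 0) ?_
    (right_mem_Icc.2 (show t ≤ c by linarith))
  · simp only [sub_self, mul_zero, Real.cosh_zero, Real.sinh_zero, mul_one, sub_zero] at key
    linarith
  · intro s hs hzero
    have hneg : Real.sinh (l * (s - c)) < 0 :=
      Real.sinh_neg_iff.2 (mul_neg_of_pos_of_neg hlpos (by linarith [hs.2]))
    have h1 := mul_le_mul_of_nonpos_right (hle s (hsub s (Ico_subset_Icc_self hs))) hneg.le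
    have h2 : (l ^ 2 - k ^ 2) * Real.sinh (l * (s - c)) < 0 :=
      mul_neg_of_pos_of_neg (by nlinarith) hneg
    have h3 : u s * (l * Real.cosh (l * (s - c))) = u s * (u s * Real.sinh (l * (s - c))) := by
      rw [sub_eq_zero.1 hzero]
    linarith

/-- Lower Riccati comparison bound: a symmetric solution of `U' + U² + R = 0` on `(a,b)`
with `R ≥ -k² Id` satisfies `⟨U(t)x,x⟩ ≥ k coth(k(t-b)) ‖x‖²`. -/
theorem riccati_coth_lower_bound {n : ℕ} (k a b : ℝ) (hk : 0 < k) (hab : a < b)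
    (U U' R : ℝ → Matrix (Fin n) (Fin n) ℝ)
    (hderiv : ∀ t ∈ Ioo a b, ∀ i j, HasDerivAt (fun s => U s i j) (U' t i j) t)
    (hUsymm : ∀ t ∈ Ioo a b, (U t)ᵀ = U t)
    (hric : ∀ t ∈ Ioo a b, U' t + U t ^ 2 + R t = 0)
    (hRsymm : ∀ t ∈ Ioo a b, (R t)ᵀ = R t)
    (hRpsd : ∀ t ∈ Ioo a b, ∀ x : Fin n → ℝ,
      0 ≤ ((R t + (k ^ 2) • (1 : Matrix (Fin n) (Fin n) ℝ)) *ᵥ x) ⬝ᵥ x) :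
    ∀ t ∈ Ioo a b, ∀ x : Fin n → ℝ,
      k * coth (k * (t - b)) * (x ⬝ᵥ x) ≤ (U t *ᵥ x) ⬝ᵥ x := by
  intro t ht x
  rcases eq_or_ne x 0 with rfl | hx
  · simp
  have hN : 0 < x ⬝ᵥ x :=
    lt_of_le_of_ne (Finset.sum_nonneg fun i _ => mul_self_nonneg (x i))
      fun h => hx (dotProduct_self_eq_zero.1 h.symm)
  have hq : ∀ s ∈ Ioo a b, HasDerivAt (fun s => (U s *ᵥ x) ⬝ᵥ x / (x ⬝ᵥ x))
      ((U' s *ᵥ x) ⬝ᵥ x / (x ⬝ᵥ x)) s := by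
    intro s hs
    refine HasDerivAt.div_const ?_ _
    simp only [dotProduct, mulVec]
    exact HasDerivAt.fun_sum fun i _ =>
      (HasDerivAt.fun_sum fun j _ => (hderiv s hs i j).mul_const (x j)).mul_const (x i)
  have hle : ∀ s ∈ Ioo a b, (U' s *ᵥ x) ⬝ᵥ x / (x ⬝ᵥ x)
      ≤ k ^ 2 - ((U s *ᵥ x) ⬝ᵥ x / (x ⬝ᵥ x)) ^ 2 := by
    intro s hs
    have hsq : (U s ^ 2 *ᵥ x) ⬝ᵥ x = (U s *ᵥ x) ⬝ᵥ (U s *ᵥ x) := by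
      rw [pow_two, ← mulVec_mulVec, dotProduct_comm, dotProduct_mulVec, ← mulVec_transpose,
        hUsymm s hs]
    have hCS : ((U s *ᵥ x) ⬝ᵥ x) ^ 2 ≤ ((U s *ᵥ x) ⬝ᵥ (U s *ᵥ x)) * (x ⬝ᵥ x) := by
      simpa only [dotProduct, pow_two] using
        Finset.sum_mul_sq_le_sq_mul_sq Finset.univ (U s *ᵥ x) x
    have hR := hRpsd s hs x
    rw [add_mulVec, add_dotProduct, smul_mulVec, one_mulVec, smul_dotProduct,
      smul_eq_mul] at hR
    have hsum := congrArg (fun A => (A *ᵥ x) ⬝ᵥ x) (hric s hs)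
    simp only [add_mulVec, add_dotProduct, zero_mulVec, zero_dotProduct, hsq] at hsum
    have hdiv : ((U s *ᵥ x) ⬝ᵥ x) ^ 2 / (x ⬝ᵥ x) ≤ (U s *ᵥ x) ⬝ᵥ (U s *ᵥ x) :=
      (div_le_iff₀ hN).2 hCS
    rw [div_le_iff₀ hN]
    calc (U' s *ᵥ x) ⬝ᵥ x ≤ k ^ 2 * (x ⬝ᵥ x) - ((U s *ᵥ x) ⬝ᵥ x) ^ 2 / (x ⬝ᵥ x) := by linarith
      _ = _ := by field_simp
  exact (le_div_iff₀ hN).1 (coth_le_of_deriv_le_sq_sub_sq hk hq hle ht)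
end

section
/- Let $k>0$, $s>0$, $t_0\in\mathbb{R}$, and let $X,R:(t_0-s,t_0+s)\to \mathrm{Mat}_{n\times n}(\mathbb{R})$ be such that: $X$ solves the matrix Jacobi equation $X''(t)+R(t)X(t)=0$; $X(t)$ is invertible for every $t$; $X'(t)X(t)^{-1}$ is symmetric for every $t$; and $R(t)$ is symmetric with $R(t)+k^2\,\mathrm{Id}$ positive semidefinite for every $t$. Then for every $v\in\mathbb{R}^n$, $\|X'(t_0)v\| \le k\coth(ks)\,\|X(t_0)v\|$. -/
open Matrix Set

/-- Upper bound for a scalar Riccati inequality, in the form satisfied by `f t = ⟪U t x, x⟫`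
with `q t = ‖U t x‖ ^ 2` and `N = ‖x‖ ^ 2`. -/
theorem riccati_upper_bound_of_lt {k s t₀ N r : ℝ} (hk : 0 < k) (hr : 0 < r) (hrs : r < s)
    {f f' q : ℝ → ℝ}
    (hf : ∀ t ∈ Ioo (t₀ - s) (t₀ + s), HasDerivAt f (f' t) t)
    (hf' : ∀ t ∈ Ioo (t₀ - s) (t₀ + s), f' t ≤ k ^ 2 * N - q t)
    (hq : ∀ t ∈ Ioo (t₀ - s) (t₀ + s), ∀ a : ℝ, 2 * a * f t ≤ a ^ 2 * N + q t) :
    f t₀ ≤ k * coth (k * r) * N := by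
  set φ : ℝ → ℝ := fun t => Real.sinh (k * (t - (t₀ - r)))
  set ψ : ℝ → ℝ := fun t => Real.cosh (k * (t - (t₀ - r)))
  have hlin (t : ℝ) : HasDerivAt (fun u => k * (u - (t₀ - r))) k t := by
    simpa using ((hasDerivAt_id t).sub_const (t₀ - r)).const_mul k
  have hφ (t : ℝ) : HasDerivAt φ (ψ t * k) t := (hlin t).sinh
  have hψ (t : ℝ) : HasDerivAt ψ (φ t * k) t := (hlin t).cosh
  have hmem : ∀ t ∈ Icc (t₀ - r) t₀, t ∈ Ioo (t₀ - s) (t₀ + s) := fun t ht =>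
    ⟨by linarith [ht.1], by linarith [ht.2]⟩
  have hg : ∀ t ∈ Icc (t₀ - r) t₀, HasDerivAt (fun u => φ u * φ u * f u - k * N * (φ u * ψ u))
      ((ψ t * k * φ t + φ t * (ψ t * k)) * f t + φ t * φ t * f' t -
        k * N * (ψ t * k * ψ t + φ t * (φ t * k))) t := fun t ht =>
    (((hφ t).mul (hφ t)).mul (hf t (hmem t ht))).sub (((hφ t).mul (hψ t)).const_mul (k * N))
  have hanti : AntitoneOn (fun u => φ u * φ u * f u - k * N * (φ u * ψ u)) (Icc (t₀ - r) t₀) := by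
    refine antitoneOn_of_hasDerivWithinAt_nonpos (convex_Icc _ _)
      (fun t ht => (hg t ht).continuousAt.continuousWithinAt)
      (fun t ht => (hg t (interior_subset ht)).hasDerivWithinAt) fun t ht => ?_
    have hφpos : 0 < φ t :=
      Real.sinh_pos_iff.2 (mul_pos hk (sub_pos.2 (interior_Icc.subset ht).1))
    have ht := interior_subset ht
    have h1 := hf' t (hmem t ht)
    have h2 := hq t (hmem t ht) (ψ t * k / φ t)
    have h3 := mul_le_mul_of_nonneg_left h2 (mul_self_nonneg (φ t))
    have h4 : φ t * φ t * (2 * (ψ t * k / φ t) * f t) = 2 * (ψ t * k * φ t * f t) := by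
      field_simp
    have h5 : φ t * φ t * ((ψ t * k / φ t) ^ 2 * N + q t)
        = (ψ t * k) ^ 2 * N + φ t * φ t * q t := by
      field_simp
    have h6 := mul_le_mul_of_nonneg_left h1 (mul_self_nonneg (φ t))
    rw [h4, h5] at h3
    nlinarith
  have hle := hanti (left_mem_Icc.2 (by linarith)) (right_mem_Icc.2 (by linarith))
    (by linarith : t₀ - r ≤ t₀)
  have hpos : 0 < Real.sinh (k * r) := Real.sinh_pos_iff.2 (mul_pos hk hr)
  simp only [φ, ψ, sub_self, mul_zero, Real.sinh_zero, zero_mul, sub_sub_cancel] at hle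
  rw [coth, mul_div_assoc', div_mul_eq_mul_div, le_div_iff₀ hpos]
  refine le_of_mul_le_mul_left ?_ hpos
  linarith

theorem riccati_upper_bound {k s t₀ N : ℝ} (hk : 0 < k) (hs : 0 < s)
    {f f' q : ℝ → ℝ}
    (hf : ∀ t ∈ Ioo (t₀ - s) (t₀ + s), HasDerivAt f (f' t) t)
    (hf' : ∀ t ∈ Ioo (t₀ - s) (t₀ + s), f' t ≤ k ^ 2 * N - q t)
    (hq : ∀ t ∈ Ioo (t₀ - s) (t₀ + s), ∀ a : ℝ, 2 * a * f t ≤ a ^ 2 * N + q t) :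
    f t₀ ≤ k * coth (k * s) * N := by
  have hcont : ContinuousAt (fun r => k * coth (k * r) * N) s := by
    have : Real.sinh (k * s) ≠ 0 := (Real.sinh_pos_iff.2 (mul_pos hk hs)).ne'
    unfold coth
    fun_prop (disch := assumption)
  refine ge_of_tendsto (hcont.tendsto.mono_left (nhdsWithin_le_nhds (s := Iio s))) ?_
  filter_upwards [Ioo_mem_nhdsLT hs] with r hr
  exact riccati_upper_bound_of_lt hk hr.1 hr.2 hf hf' hq

theorem riccati_abs_bound {k s t₀ N : ℝ} (hk : 0 < k) (hs : 0 < s)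
    {f f' q : ℝ → ℝ}
    (hf : ∀ t ∈ Ioo (t₀ - s) (t₀ + s), HasDerivAt f (f' t) t)
    (hf' : ∀ t ∈ Ioo (t₀ - s) (t₀ + s), f' t ≤ k ^ 2 * N - q t)
    (hq : ∀ t ∈ Ioo (t₀ - s) (t₀ + s), ∀ a : ℝ, 2 * a * f t ≤ a ^ 2 * N + q t) :
    |f t₀| ≤ k * coth (k * s) * N := by
  have hmem : ∀ t ∈ Ioo (t₀ - s) (t₀ + s), 2 * t₀ - t ∈ Ioo (t₀ - s) (t₀ + s) := fun t ht =>
    ⟨by linarith [ht.2], by linarith [ht.1]⟩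
  have hneg := riccati_upper_bound (f := fun t => -f (2 * t₀ - t)) (f' := fun t => f' (2 * t₀ - t))
    (q := fun t => q (2 * t₀ - t)) (N := N) hk hs
    (fun t ht => by simpa using ((hf _ (hmem t ht)).comp_const_sub (2 * t₀) t).fun_neg)
    (fun t ht => hf' _ (hmem t ht))
    (fun t ht a => by linarith [hq _ (hmem t ht) (-a)])
  rw [show 2 * t₀ - t₀ = t₀ by ring] at hneg
  exact abs_le.2 ⟨by linarith, riccati_upper_bound hk hs hf hf' hq⟩

/-- A symmetric matrix whose quadratic form is bounded by `c` has operator norm at most `c`. -/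
theorem Matrix.IsSymm.mulVec_dotProduct_self_le {ι : Type*} [Fintype ι] {A : Matrix ι ι ℝ}
    (hA : A.IsSymm) {c : ℝ} (hc : 0 < c) (h : ∀ x, |(A *ᵥ x) ⬝ᵥ x| ≤ c * (x ⬝ᵥ x)) (x : ι → ℝ) :
    (A *ᵥ x) ⬝ᵥ (A *ᵥ x) ≤ c ^ 2 * (x ⬝ᵥ x) := by
  have hswap (y : ι → ℝ) : (A *ᵥ y) ⬝ᵥ x = (A *ᵥ x) ⬝ᵥ y := by
    rw [dotProduct_comm, dotProduct_mulVec, ← mulVec_transpose, hA.eq]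
  have h1 := (abs_le.1 (h (c • x + A *ᵥ x))).2
  have h2 := (abs_le.1 (h (c • x - A *ᵥ x))).1
  have h3 := hswap (A *ᵥ x)
  simp only [mulVec_add, mulVec_sub, mulVec_smul, add_dotProduct, dotProduct_add, sub_dotProduct,
    dotProduct_sub, smul_dotProduct, dotProduct_smul, smul_eq_mul, h3,
    dotProduct_comm x (A *ᵥ x)] at h1 h2
  refine le_of_mul_le_mul_left ?_ hc
  nlinarith

section

attribute [local instance] Matrix.linftyOpNormedRing Matrix.linftyOpNormedAlgebra

theorem Matrix.hasDerivAt_mul_inv {n : ℕ} {X Y : ℝ → Matrix (Fin n) (Fin n) ℝ}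
    {X' Y' : Matrix (Fin n) (Fin n) ℝ} {t : ℝ}
    (hX : ∀ i j, HasDerivAt (fun u => X u i j) (X' i j) t)
    (hY : ∀ i j, HasDerivAt (fun u => Y u i j) (Y' i j) t)
    (hinv : IsUnit (X t).det) (i j : Fin n) :
    HasDerivAt (fun u => (Y u * (X u)⁻¹) i j)
      ((Y' * (X t)⁻¹ - Y t * (X t)⁻¹ * (X' * (X t)⁻¹)) i j) t := by
  have hX' : HasDerivAt X X' t := hasDerivAt_pi.2 fun i => hasDerivAt_pi.2 (hX i)
  have hY' : HasDerivAt Y Y' t := hasDerivAt_pi.2 fun i => hasDerivAt_pi.2 (hY i)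
  obtain ⟨u, hu⟩ := (isUnit_iff_isUnit_det _).2 hinv
  have hR := hasFDerivAt_ringInverse (𝕜 := ℝ) u
  rw [hu] at hR
  have hI := hR.comp_hasDerivAt t hX'
  simp only [Function.comp_def, ← nonsing_inv_eq_ringInverse, coe_units_inv, hu,
    _root_.neg_apply, ContinuousLinearMap.mulLeftRight_apply] at hI
  have h := hY'.fun_mul hI
  rw [show Y' * (X t)⁻¹ + Y t * -((X t)⁻¹ * X' * (X t)⁻¹) =
    Y' * (X t)⁻¹ - Y t * (X t)⁻¹ * (X' * (X t)⁻¹) by noncomm_ring] at h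
  exact hasDerivAt_pi.1 (hasDerivAt_pi.1 h i) j

end

/-- Quantitative bound of Proposition A.1: if `X` solves the matrix Jacobi equation
`X'' + R X = 0` on `(t₀-s, t₀+s)` with `X` invertible, `U = X' X⁻¹` symmetric, and
`R ≥ -k² Id`, then `‖X'(t₀)v‖ ≤ k coth(ks) ‖X(t₀)v‖` for every vector `v`
(with the Euclidean norm written via `√(w ⬝ᵥ w)`). -/
theorem jacobi_derivative_bound {n : ℕ} (k s t₀ : ℝ) (hk : 0 < k) (hs : 0 < s)
    (X X' X'' R : ℝ → Matrix (Fin n) (Fin n) ℝ)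
    (hd1 : ∀ t ∈ Ioo (t₀ - s) (t₀ + s), ∀ i j,
      HasDerivAt (fun u => X u i j) (X' t i j) t)
    (hd2 : ∀ t ∈ Ioo (t₀ - s) (t₀ + s), ∀ i j,
      HasDerivAt (fun u => X' u i j) (X'' t i j) t)
    (hjac : ∀ t ∈ Ioo (t₀ - s) (t₀ + s), X'' t + R t * X t = 0)
    (hinv : ∀ t ∈ Ioo (t₀ - s) (t₀ + s), IsUnit (X t).det)
    (hUsymm : ∀ t ∈ Ioo (t₀ - s) (t₀ + s), (X' t * (X t)⁻¹)ᵀ = X' t * (X t)⁻¹)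
    (hRsymm : ∀ t ∈ Ioo (t₀ - s) (t₀ + s), (R t)ᵀ = R t)
    (hRpsd : ∀ t ∈ Ioo (t₀ - s) (t₀ + s), ∀ x : Fin n → ℝ,
      0 ≤ ((R t + (k ^ 2) • (1 : Matrix (Fin n) (Fin n) ℝ)) *ᵥ x) ⬝ᵥ x) :
    ∀ v : Fin n → ℝ,
      Real.sqrt ((X' t₀ *ᵥ v) ⬝ᵥ (X' t₀ *ᵥ v)) ≤
        k * coth (k * s) * Real.sqrt ((X t₀ *ᵥ v) ⬝ᵥ (X t₀ *ᵥ v)) := by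
  have hmem : t₀ ∈ Ioo (t₀ - s) (t₀ + s) := ⟨by linarith, by linarith⟩
  have hks : 0 < k * s := mul_pos hk hs
  have hc : 0 < k * coth (k * s) :=
    mul_pos hk (div_pos (Real.cosh_pos _) (Real.sinh_pos_iff.2 hks))
  set U : ℝ → Matrix (Fin n) (Fin n) ℝ := fun t => X' t * (X t)⁻¹ with hU
  have hswap : ∀ t ∈ Ioo (t₀ - s) (t₀ + s), ∀ x y : Fin n → ℝ,
      (U t *ᵥ y) ⬝ᵥ x = (U t *ᵥ x) ⬝ᵥ y := fun t ht x y => by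
    rw [dotProduct_comm, dotProduct_mulVec, ← mulVec_transpose, hUsymm t ht]
  have hUd : ∀ t ∈ Ioo (t₀ - s) (t₀ + s), ∀ i j,
      HasDerivAt (fun u => U u i j) ((-R t - U t * U t) i j) t := fun t ht i j => by
    have h := Matrix.hasDerivAt_mul_inv (hd1 t ht) (hd2 t ht) (hinv t ht) i j
    rwa [eq_neg_of_add_eq_zero_left (hjac t ht), neg_mul,
      mul_nonsing_inv_cancel_right _ _ (hinv t ht)] at h
  have hquad (x : Fin n → ℝ) : |(U t₀ *ᵥ x) ⬝ᵥ x| ≤ k * coth (k * s) * (x ⬝ᵥ x) := by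
    refine riccati_abs_bound (f := fun t => (U t *ᵥ x) ⬝ᵥ x)
      (f' := fun t => ((-R t - U t * U t) *ᵥ x) ⬝ᵥ x)
      (q := fun t => (U t *ᵥ x) ⬝ᵥ (U t *ᵥ x)) hk hs (fun t ht => ?_) (fun t ht => ?_)
      (fun t ht a => ?_)
    · simp only [dotProduct, mulVec]
      exact HasDerivAt.fun_sum fun i _ =>
        (HasDerivAt.fun_sum fun j _ => (hUd t ht i j).mul_const (x j)).mul_const (x i)
    · have h := hRpsd t ht x
      simp only [add_mulVec, smul_mulVec, one_mulVec, add_dotProduct, smul_dotProduct,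
        smul_eq_mul] at h
      simp only [sub_mulVec, neg_mulVec, sub_dotProduct, neg_dotProduct, ← mulVec_mulVec,
        hswap t ht x (U t *ᵥ x)]
      linarith
    · have h : 0 ≤ (a • x - U t *ᵥ x) ⬝ᵥ (a • x - U t *ᵥ x) :=
        Finset.sum_nonneg fun i _ => mul_self_nonneg _
      simp only [sub_dotProduct, dotProduct_sub, smul_dotProduct, dotProduct_smul, smul_eq_mul,
        dotProduct_comm x (U t *ᵥ x)] at h
      linarith
  intro v
  have hX' : X' t₀ *ᵥ v = U t₀ *ᵥ (X t₀ *ᵥ v) := by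
    rw [mulVec_mulVec, hU, nonsing_inv_mul_cancel_right _ _ (hinv t₀ hmem)]
  rw [hX']
  refine Real.sqrt_le_iff.2 ⟨by positivity, ?_⟩
  have hnonneg : 0 ≤ (X t₀ *ᵥ v) ⬝ᵥ (X t₀ *ᵥ v) := Finset.sum_nonneg fun i _ => mul_self_nonneg _
  rw [mul_pow, Real.sq_sqrt hnonneg]
  exact Matrix.IsSymm.mulVec_dotProduct_self_le (hUsymm t₀ hmem) hc hquad _
end

section
/- Let $m_0,m_1,m_2$ be positive integers and let $f:\mathbb{R}^{m_0}\times\mathbb{R}^{m_1}\times\mathbb{R}^{m_2}\to\mathbb{R}^{m_0}$ be twice continuously differentiable with $f(0,0,0)=0$ and such that the partial differential $D_{x_0}f(0,0,0)$ is invertible with inverse $L$. Suppose that for each $i\in\{0,1,2\}$ and each coordinate direction in the block $x_i$, the corresponding first-order partial derivative of $f$ is bounded in norm by $\tilde B_i$, and each second-order partial derivative of $f$ taken with respect to one coordinate of the block $x_i$ and one coordinate of the block $x_0$ is bounded in norm by $B_i$ (these bounds holding everywhere). Suppose $r_0,r_1,r_2>0$ satisfy $S:=\|L\|\,(m_0B_0r_0+m_1B_1r_1+m_2B_2r_2)<1$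 and $S\,r_0+\|L\|\,(m_1\tilde B_1 r_1+m_2\tilde B_2 r_2)\le r_0$. Then there exists a function $x_0:B(0,r_1)\times B(0,r_2)\to \overline{B}(0,r_0)\subset\mathbb{R}^{m_0}$ such that $f(x_0(x_1,x_2),x_1,x_2)=0$ for all $(x_1,x_2)\in B(0,r_1)\times B(0,r_2)$. -/
open Set

theorem norm_sub_sub_le_of_lipschitz_fderiv {E F : Type*} [NormedAddCommGroup E] [NormedSpace ℝ E]
    [NormedAddCommGroup F] [NormedSpace ℝ F] {φ : E → F} {φ' : E → E →L[ℝ] F} {K : ℝ}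
    (hφ : ∀ x, HasFDerivAt φ (φ' x) x) (hK : ∀ x y v, ‖φ' y v - φ' x v‖ ≤ K * ‖y - x‖ * ‖v‖)
    (x h : E) : ‖φ (x + h) - φ x - φ' x h‖ ≤ K / 2 * ‖h‖ ^ 2 := by
  have hder : ∀ s : ℝ, HasDerivAt (fun s : ℝ => φ (x + s • h) - φ x - s • φ' x h)
      (φ' (x + s • h) h - φ' x h) s := by
    intro s
    have h1 : HasDerivAt (fun s : ℝ => x + s • h) h s := by
      simpa using ((hasDerivAt_id s).smul_const h).const_add x
    have h2 := ((hφ (x + s • h)).comp_hasDerivAt s h1).sub_const (φ x)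
    have h3 : HasDerivAt (fun s : ℝ => s • φ' x h) (φ' x h) s := by
      simpa using (hasDerivAt_id s).smul_const (φ' x h)
    exact h2.sub h3
  have hB : ∀ s : ℝ, HasDerivAt (fun s : ℝ => K / 2 * ‖h‖ ^ 2 * s ^ 2) (K * ‖h‖ ^ 2 * s) s := by
    intro s
    refine ((hasDerivAt_pow 2 s).const_mul (K / 2 * ‖h‖ ^ 2)).congr_deriv ?_
    norm_num
    ring
  have key := image_norm_le_of_norm_deriv_right_le_deriv_boundary' (a := 0) (b := 1)
    (fun s _ => (hder s).continuousAt.continuousWithinAt)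
    (fun s _ => (hder s).hasDerivWithinAt) (by simp)
    (fun s _ => (hB s).continuousAt.continuousWithinAt)
    (fun s _ => (hB s).hasDerivWithinAt)
    (by
      intro s hs
      refine (hK x (x + s • h) h).trans (le_of_eq ?_)
      rw [add_sub_cancel_left, norm_smul, Real.norm_of_nonneg hs.1]
      ring)
  simpa using key (right_mem_Icc.2 zero_le_one)

theorem eq_zero_of_map_eq_self_of_isFixedPt {E : Type*} [NormedAddCommGroup E]
    [InnerProductSpace ℝ E] {φ : E → E} {A : E →L[ℝ] E} {x : E} {σ κ r : ℝ}
    (hσ : 0 < σ) (hκ : 0 ≤ κ) (hr : 0 < r) (hκr : κ < (1 - σ * r) * r)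
    (hT : ∀ h, ‖φ (x + h) - φ x - A h‖ ≤ σ / 2 * ‖h‖ ^ 2)
    (hb : ∀ y, ‖φ y‖ ≤ κ + σ / 2 * ‖y‖ ^ 2) (hx : φ x = x) (hxr : ‖x‖ ≤ r)
    {v : E} (hv : A v = v) : v = 0 := by
  by_contra hv0
  have hσr : σ * r < 1 := by
    by_contra! hc
    nlinarith
  -- Normalise the sign and the length of the eigenvector.
  obtain ⟨w, hw1, hAw, hwx⟩ : ∃ w : E, ‖w‖ = 1 ∧ A w = w ∧ 0 ≤ inner ℝ x w := by
    have hn : ‖(‖v‖⁻¹ • v)‖ = 1 := by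
      rw [norm_smul, norm_inv, norm_norm, inv_mul_cancel₀ (norm_ne_zero_iff.2 hv0)]
    rcases le_total 0 (inner ℝ x (‖v‖⁻¹ • v)) with h | h
    · exact ⟨_, hn, by rw [map_smul, hv], h⟩
    · exact ⟨-(‖v‖⁻¹ • v), by rw [norm_neg, hn], by rw [map_neg, map_smul, hv],
        by rw [inner_neg_right]; linarith⟩
  have hκσ : κ < 1 / (4 * σ) := by
    rw [lt_div_iff₀ (by positivity)]
    nlinarith [sq_nonneg (2 * (σ * r) - 1)]
  have hxsmall : ‖x‖ ≤ 1 / (2 * σ) := by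
    by_contra! hc
    have h1 := hb x
    rw [hx] at h1
    have h2 : 1 < 2 * (σ * ‖x‖) := by
      rw [div_lt_iff₀ (by positivity)] at hc
      linarith
    have h3 : κ * (4 * σ) < 1 := by rwa [lt_div_iff₀ (by positivity)] at hκσ
    have h4 : σ * ‖x‖ < 1 := by nlinarith
    nlinarith
  have hcont : Continuous fun h : ℝ => ‖x + h • w‖ := by fun_prop
  have hnormsq : ∀ h : ℝ, ‖x + h • w‖ ^ 2 = ‖x‖ ^ 2 + 2 * h * inner ℝ x w + h ^ 2 := by
    intro h
    rw [norm_add_sq_real, inner_smul_right, norm_smul, hw1, mul_one, Real.norm_eq_abs, sq_abs]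
    ring
  have hR0 : 0 < 1 / (2 * σ) := by positivity
  have hlarge : ∀ h : ℝ, 0 ≤ h → h ≤ ‖x + h • w‖ := by
    intro h hh
    refine le_of_sq_le_sq ?_ (norm_nonneg _)
    rw [hnormsq]
    nlinarith [sq_nonneg ‖x‖, mul_nonneg hh hwx]
  obtain ⟨h, hh, hhR⟩ := intermediate_value_Icc hR0.le hcont.continuousOn
    (show 1 / (2 * σ) ∈ Icc ‖x + (0 : ℝ) • w‖ ‖x + (1 / (2 * σ)) • w‖ from
      ⟨by simpa using hxsmall, hlarge _ hR0.le⟩)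
  simp only at hhR
  have h1 := hT (h • w)
  rw [hx, map_smul, hAw, norm_smul, hw1, mul_one, Real.norm_eq_abs, sq_abs] at h1
  have h2 := hb (x + h • w)
  have h3 : ‖x + h • w‖ ≤ ‖φ (x + h • w)‖ + ‖φ (x + h • w) - x - h • w‖ := by
    have : x + h • w = φ (x + h • w) - (φ (x + h • w) - x - h • w) := by abel
    calc ‖x + h • w‖ = ‖φ (x + h • w) - (φ (x + h • w) - x - h • w)‖ := by rw [← this]
      _ ≤ _ := norm_sub_le _ _
  rw [hhR] at h2 h3
  have h4 : h ^ 2 ≤ (1 / (2 * σ)) ^ 2 := pow_le_pow_left₀ hh.1 hh.2 2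
  have h5 : σ / 2 * (1 / (2 * σ)) ^ 2 = 1 / (4 * σ) / 2 := by field_simp; norm_num
  have h6 : 1 / (2 * σ) = 2 * (1 / (4 * σ)) := by field_simp; norm_num
  nlinarith

theorem exists_isFixedPt_of_homotopy {E : Type*} [NormedAddCommGroup E]
    [InnerProductSpace ℝ E] [FiniteDimensional ℝ E] {F : ℝ × E → E} (hF : ContDiff ℝ 1 F)
    {σ κ r : ℝ} (hσ : 0 < σ) (hκ : 0 ≤ κ) (hr : 0 < r) (hκr : κ < (1 - σ * r) * r)
    (hT : ∀ t x h, ‖F (t, x + h) - F (t, x) - fderiv ℝ F (t, x) (0, h)‖ ≤ σ / 2 * ‖h‖ ^ 2)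
    (hb : ∀ t ∈ Icc (0 : ℝ) 1, ∀ x, ‖F (t, x)‖ ≤ κ + σ / 2 * ‖x‖ ^ 2) (h0 : F (0, 0) = 0) :
    ∃ x, ‖x‖ ≤ r ∧ F (1, x) = x := by
  set T : Set ℝ := {t | ∃ x, ‖x‖ ≤ r ∧ F (t, x) = x} with hTdef
  have hFc := hF.continuous
  have hclosed : IsClosed (T ∩ Icc 0 1) := by
    have hK : IsCompact ((Icc (0 : ℝ) 1 ×ˢ Metric.closedBall (0 : E) r) ∩
        {p : ℝ × E | F p = p.2}) :=
      (isCompact_Icc.prod (isCompact_closedBall _ _)).inter_right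
        (isClosed_eq hFc continuous_snd)
    convert (hK.image continuous_fst).isClosed using 1
    ext t
    constructor
    · rintro ⟨⟨x, hx, hFx⟩, ht⟩
      exact ⟨(t, x), ⟨⟨ht, by simpa using hx⟩, hFx⟩, rfl⟩
    · rintro ⟨⟨t, x⟩, ⟨⟨ht, hx⟩, hFx⟩, rfl⟩
      exact ⟨⟨x, by simpa using hx, hFx⟩, ht⟩
  refine IsClosed.Icc_subset_of_forall_mem_nhdsWithin hclosed ⟨0, by simpa using hr.le, h0⟩ ?_
    (right_mem_Icc.2 zero_le_one)
  rintro t ⟨⟨x, hxr, hFx⟩, ht⟩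
  refine nhdsWithin_le_nhds ?_
  have ht' : t ∈ Icc (0 : ℝ) 1 := ⟨ht.1, ht.2.le⟩
  have hσr : σ * r < 1 := by
    by_contra! hc
    nlinarith
  have hxlt : ‖x‖ < r := by
    have h1 := hb t ht' x
    rw [hFx] at h1
    have h2 : ‖x‖ ^ 2 ≤ r ^ 2 := pow_le_pow_left₀ (norm_nonneg _) hxr 2
    nlinarith [mul_pos hσ (mul_pos hr hr)]
  set A : E →L[ℝ] E := (fderiv ℝ F (t, x)).comp (ContinuousLinearMap.inr ℝ ℝ E) with hA
  have hinj : Function.Injective (ContinuousLinearMap.id ℝ E - A).toLinearMap := by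
    rw [← LinearMap.ker_eq_bot, LinearMap.ker_eq_bot']
    intro v hv
    refine eq_zero_of_map_eq_self_of_isFixedPt (φ := fun y => F (t, y)) (A := A) hσ hκ hr hκr
      (fun h => by simpa [hA] using hT t x h) (hb t ht') hFx hxr ?_
    have : v - A v = 0 := hv
    exact (sub_eq_zero.1 this).symm
  have hsurj := LinearMap.injective_iff_surjective.1 hinj
  have hstrict : HasStrictFDerivAt (fun p : ℝ × E => (p.1, p.2 - F p))
      ((ContinuousLinearMap.fst ℝ ℝ E).prod
        (ContinuousLinearMap.snd ℝ ℝ E - fderiv ℝ F (t, x))) (t, x) :=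
    hasStrictFDerivAt_fst.prodMk
      (hasStrictFDerivAt_snd.sub (hF.contDiffAt.hasStrictFDerivAt one_ne_zero))
  have hrange : ((ContinuousLinearMap.fst ℝ ℝ E).prod
      (ContinuousLinearMap.snd ℝ ℝ E - fderiv ℝ F (t, x))).range = ⊤ := by
    refine LinearMap.range_eq_top.2 ?_
    rintro ⟨s, w⟩
    obtain ⟨v, hv⟩ := hsurj (w + fderiv ℝ F (t, x) (s, 0))
    have hv' : v - fderiv ℝ F (t, x) (0, v) = w + fderiv ℝ F (t, x) (s, 0) := hv
    refine ⟨(s, v), Prod.ext rfl ?_⟩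
    have hs : fderiv ℝ F (t, x) (s, v)
        = fderiv ℝ F (t, x) (s, 0) + fderiv ℝ F (t, x) (0, v) := by
      rw [← map_add]; simp
    change v - fderiv ℝ F (t, x) (s, v) = w
    rw [hs, ← sub_sub, sub_right_comm, hv', add_sub_cancel_right]
  have hmap := hstrict.map_nhds_eq_of_surj hrange
  have hball : {p : ℝ × E | ‖p.2‖ < r} ∈ nhds (t, x) :=
    (isOpen_lt (by fun_prop) continuous_const).mem_nhds hxlt
  have himg := Filter.image_mem_map (m := fun p : ℝ × E => (p.1, p.2 - F p)) hball
  rw [hmap] at himg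
  simp only [hFx, sub_self] at himg
  have hline : Filter.Tendsto (fun s : ℝ => (s, (0 : E))) (nhds t) (nhds (t, 0)) :=
    (Continuous.prodMk_left (0 : E)).tendsto t
  filter_upwards [hline himg] with s hs
  obtain ⟨⟨s', y⟩, hy, heq⟩ := hs
  obtain ⟨rfl, h2⟩ := Prod.mk.inj heq
  exact ⟨y, le_of_lt hy, (sub_eq_zero.1 h2).symm⟩

theorem norm_map_le_of_norm_map_single_le {n : ℕ} {G : Type*} [NormedAddCommGroup G]
    [NormedSpace ℝ G] (A : EuclideanSpace ℝ (Fin n) →L[ℝ] G) {C : ℝ} (hC : 0 ≤ C)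
    (hA : ∀ j, ‖A (EuclideanSpace.single j 1)‖ ≤ C) (v : EuclideanSpace ℝ (Fin n)) :
    ‖A v‖ ≤ √n * C * ‖v‖ := by
  have hv : A v = ∑ j, v j • A (EuclideanSpace.single j 1) := by
    conv_lhs => rw [← (EuclideanSpace.basisFun (Fin n) ℝ).sum_repr v]
    simp
  have hsum : ∑ j, |v j| ≤ √n * ‖v‖ := by
    rw [EuclideanSpace.norm_eq, ← Real.sqrt_mul (Nat.cast_nonneg n)]
    refine Real.le_sqrt_of_sq_le ?_
    simpa using sq_sum_le_card_mul_sum_sq (s := Finset.univ) (f := fun j => |v j|)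
  calc ‖A v‖ ≤ ∑ j, |v j| * C := by
        rw [hv]
        refine (norm_sum_le _ _).trans (Finset.sum_le_sum fun j _ => ?_)
        rw [norm_smul, Real.norm_eq_abs]
        exact mul_le_mul_of_nonneg_left (hA j) (abs_nonneg _)
    _ = (∑ j, |v j|) * C := by rw [Finset.sum_mul]
    _ ≤ √n * ‖v‖ * C := mul_le_mul_of_nonneg_right hsum hC
    _ = √n * C * ‖v‖ := by ring

theorem norm_image_sub_le_of_norm_partial_le {n : ℕ} {G : Type*} [NormedAddCommGroup G]
    [NormedSpace ℝ G] {φ : EuclideanSpace ℝ (Fin n) → G}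
    {φ' : EuclideanSpace ℝ (Fin n) → EuclideanSpace ℝ (Fin n) →L[ℝ] G}
    (hφ : ∀ x, HasFDerivAt φ (φ' x) x) {C : ℝ} (hC : 0 ≤ C)
    (hbound : ∀ x j, ‖φ' x (EuclideanSpace.single j 1)‖ ≤ C) (x y : EuclideanSpace ℝ (Fin n)) :
    ‖φ y - φ x‖ ≤ √n * C * ‖y - x‖ :=
  convex_univ.norm_image_sub_le_of_norm_hasFDerivWithin_le
    (fun z _ => (hφ z).hasFDerivWithinAt)
    (fun z _ => ContinuousLinearMap.opNorm_le_bound _ (by positivity)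
      (norm_map_le_of_norm_map_single_le (φ' z) hC (hbound z))) (mem_univ x) (mem_univ y)

theorem norm_fderiv_sub_le_of_norm_second_partial_le {n : ℕ} {Z G : Type*}
    [NormedAddCommGroup Z] [NormedSpace ℝ Z] [NormedAddCommGroup G] [NormedSpace ℝ G]
    {f : EuclideanSpace ℝ (Fin n) × Z → G} (hf : ContDiff ℝ 2 f) {B : ℝ} (hB : 0 ≤ B)
    (h2nd : ∀ p, ∀ j j₀ : Fin n,
      ‖fderiv ℝ (fun q => fderiv ℝ f q (EuclideanSpace.single j 1, 0)) p
        (EuclideanSpace.single j₀ 1, 0)‖ ≤ B) (z : Z) (x y v : EuclideanSpace ℝ (Fin n)) :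
    ‖fderiv ℝ f (y, z) (v, 0) - fderiv ℝ f (x, z) (v, 0)‖ ≤ n * B * ‖y - x‖ * ‖v‖ := by
  have hf' : ContDiff ℝ 1 (fderiv ℝ f) := hf.fderiv_right (by norm_num)
  have hpartial : ∀ j : Fin n, ‖fderiv ℝ f (y, z) (EuclideanSpace.single j 1, 0)
      - fderiv ℝ f (x, z) (EuclideanSpace.single j 1, 0)‖ ≤ √n * B * ‖y - x‖ := by
    intro j
    have hd : Differentiable ℝ fun q => fderiv ℝ f q (EuclideanSpace.single j 1, 0) :=
      (hf'.clm_apply contDiff_const).differentiable one_ne_zero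
    exact norm_image_sub_le_of_norm_partial_le
      (φ := fun x => fderiv ℝ f (x, z) (EuclideanSpace.single j 1, 0))
      (φ' := fun x => (fderiv ℝ (fun q => fderiv ℝ f q (EuclideanSpace.single j 1, 0)) (x, z)).comp
        (ContinuousLinearMap.inl ℝ _ Z))
      (fun x => HasFDerivAt.comp
        (g := fun q => fderiv ℝ f q (EuclideanSpace.single j 1, 0)) (f := fun x => (x, z)) x
        (hd (x, z)).hasFDerivAt (hasFDerivAt_prodMk_left x z)) hB
      (fun x j₀ => h2nd (x, z) j j₀) x y
  have h := norm_map_le_of_norm_map_single_le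
    ((fderiv ℝ f (y, z) - fderiv ℝ f (x, z)).comp (ContinuousLinearMap.inl ℝ _ Z))
    (by positivity) (fun j => hpartial j) v
  calc _ ≤ √n * (√n * B * ‖y - x‖) * ‖v‖ := h
    _ = √n * √n * B * ‖y - x‖ * ‖v‖ := by ring
    _ = _ := by rw [Real.mul_self_sqrt (Nat.cast_nonneg n)]

theorem norm_sub_le_of_norm_partial_le {X G : Type*} [NormedAddCommGroup X] [NormedSpace ℝ X]
    [NormedAddCommGroup G] [NormedSpace ℝ G] {m n : ℕ}
    {f : X × EuclideanSpace ℝ (Fin m) × EuclideanSpace ℝ (Fin n) → G} (hf : Differentiable ℝ f)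
    {C D : ℝ} (hC : 0 ≤ C) (hD : 0 ≤ D)
    (hfC : ∀ p, ∀ j : Fin m, ‖fderiv ℝ f p (0, EuclideanSpace.single j 1, 0)‖ ≤ C)
    (hfD : ∀ p, ∀ j : Fin n, ‖fderiv ℝ f p (0, 0, EuclideanSpace.single j 1)‖ ≤ D)
    (x : X) (y : EuclideanSpace ℝ (Fin m)) (z : EuclideanSpace ℝ (Fin n)) :
    ‖f (x, y, z) - f (x, 0, 0)‖ ≤ m * C * ‖y‖ + n * D * ‖z‖ := by
  have hsqrt : ∀ k : ℕ, √(k : ℝ) ≤ k := fun k => by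
    rw [Real.sqrt_le_left (Nat.cast_nonneg k)]
    exact_mod_cast Nat.le_self_pow two_ne_zero k
  have h1 := norm_image_sub_le_of_norm_partial_le (φ := fun y => f (x, y, 0))
    (φ' := fun y => (fderiv ℝ f (x, y, 0)).comp
      ((ContinuousLinearMap.inr ℝ X _).comp (ContinuousLinearMap.inl ℝ _ _)))
    (fun y => (hf (x, y, 0)).hasFDerivAt.comp y
      ((hasFDerivAt_prodMk_right x (y, (0 : EuclideanSpace ℝ (Fin n)))).comp y
        (hasFDerivAt_prodMk_left y (0 : EuclideanSpace ℝ (Fin n)))))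
    hC (fun y j => hfC (x, y, 0) j) 0 y
  have h2 := norm_image_sub_le_of_norm_partial_le (φ := fun z => f (x, y, z))
    (φ' := fun z => (fderiv ℝ f (x, y, z)).comp
      ((ContinuousLinearMap.inr ℝ X _).comp (ContinuousLinearMap.inr ℝ _ _)))
    (fun z => (hf (x, y, z)).hasFDerivAt.comp z
      ((hasFDerivAt_prodMk_right x (y, z)).comp z (hasFDerivAt_prodMk_right y z)))
    hD (fun z j => hfD (x, y, z) j) 0 z
  rw [sub_zero] at h1 h2
  calc ‖f (x, y, z) - f (x, 0, 0)‖
      ≤ ‖f (x, y, z) - f (x, y, 0)‖ + ‖f (x, y, 0) - f (x, 0, 0)‖ :=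
        norm_sub_le_norm_sub_add_norm_sub _ _ _
    _ ≤ √n * D * ‖z‖ + √m * C * ‖y‖ := add_le_add h2 h1
    _ ≤ n * D * ‖z‖ + m * C * ‖y‖ := by
        gcongr
        · exact hsqrt n
        · exact hsqrt m
    _ = _ := add_comm _ _

/-- Quantitative implicit function theorem (Lemma A.2 in the appendix): under explicit
bounds on the first and second partial derivatives of `f` and the smallness conditions
on the radii `r₀, r₁, r₂`, there is an implicit function `x₀(x₁,x₂)` defined on
`B(0,r₁) × B(0,r₂)` with values in the closed ball of radius `r₀` solving
`f(x₀(x₁,x₂), x₁, x₂) = 0`. -/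
theorem quantitative_implicit_function_theorem
    (m₀ m₁ m₂ : ℕ) (hm₀ : 0 < m₀) (hm₁ : 0 < m₁) (hm₂ : 0 < m₂)
    (f : EuclideanSpace ℝ (Fin m₀) × EuclideanSpace ℝ (Fin m₁) × EuclideanSpace ℝ (Fin m₂) →
      EuclideanSpace ℝ (Fin m₀))
    (hf : ContDiff ℝ 2 f)
    (hf0 : f (0, 0, 0) = 0)
    (L : EuclideanSpace ℝ (Fin m₀) →L[ℝ] EuclideanSpace ℝ (Fin m₀))
    (hL1 : ∀ v, L (fderiv ℝ f (0, 0, 0) (v, 0, 0)) = v)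
    (hL2 : ∀ v, fderiv ℝ f (0, 0, 0) (L v, 0, 0) = v)
    (B₀ B₁ B₂ tB₀ tB₁ tB₂ : ℝ)
    (h1st₀ : ∀ p, ∀ j : Fin m₀,
      ‖fderiv ℝ f p (EuclideanSpace.single j 1, 0, 0)‖ ≤ tB₀)
    (h1st₁ : ∀ p, ∀ j : Fin m₁,
      ‖fderiv ℝ f p (0, EuclideanSpace.single j 1, 0)‖ ≤ tB₁)
    (h1st₂ : ∀ p, ∀ j : Fin m₂,
      ‖fderiv ℝ f p (0, 0, EuclideanSpace.single j 1)‖ ≤ tB₂)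
    (h2nd₀ : ∀ p, ∀ j : Fin m₀, ∀ j₀ : Fin m₀,
      ‖fderiv ℝ (fun q => fderiv ℝ f q (EuclideanSpace.single j 1, 0, 0)) p
        (EuclideanSpace.single j₀ 1, 0, 0)‖ ≤ B₀)
    (h2nd₁ : ∀ p, ∀ j : Fin m₁, ∀ j₀ : Fin m₀,
      ‖fderiv ℝ (fun q => fderiv ℝ f q (0, EuclideanSpace.single j 1, 0)) p
        (EuclideanSpace.single j₀ 1, 0, 0)‖ ≤ B₁)
    (h2nd₂ : ∀ p, ∀ j : Fin m₂, ∀ j₀ : Fin m₀,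
      ‖fderiv ℝ (fun q => fderiv ℝ f q (0, 0, EuclideanSpace.single j 1)) p
        (EuclideanSpace.single j₀ 1, 0, 0)‖ ≤ B₂)
    (r₀ r₁ r₂ : ℝ) (hr₀ : 0 < r₀) (hr₁ : 0 < r₁) (hr₂ : 0 < r₂)
    (hS : ‖L‖ * (m₀ * B₀ * r₀ + m₁ * B₁ * r₁ + m₂ * B₂ * r₂) < 1)
    (hS2 : ‖L‖ * (m₀ * B₀ * r₀ + m₁ * B₁ * r₁ + m₂ * B₂ * r₂) * r₀
        + ‖L‖ * (m₁ * tB₁ * r₁ + m₂ * tB₂ * r₂) ≤ r₀) :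
    ∃ g : EuclideanSpace ℝ (Fin m₁) × EuclideanSpace ℝ (Fin m₂) →
        EuclideanSpace ℝ (Fin m₀),
      ∀ x₁ x₂, ‖x₁‖ < r₁ → ‖x₂‖ < r₂ →
        ‖g (x₁, x₂)‖ ≤ r₀ ∧ f (g (x₁, x₂), x₁, x₂) = 0 := by
  have hB₀ : 0 ≤ B₀ := (norm_nonneg _).trans (h2nd₀ 0 ⟨0, hm₀⟩ ⟨0, hm₀⟩)
  have hB₁ : 0 ≤ B₁ := (norm_nonneg _).trans (h2nd₁ 0 ⟨0, hm₁⟩ ⟨0, hm₀⟩)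
  have hB₂ : 0 ≤ B₂ := (norm_nonneg _).trans (h2nd₂ 0 ⟨0, hm₂⟩ ⟨0, hm₀⟩)
  have htB₁ : 0 ≤ tB₁ := (norm_nonneg _).trans (h1st₁ 0 ⟨0, hm₁⟩)
  have htB₂ : 0 ≤ tB₂ := (norm_nonneg _).trans (h1st₂ 0 ⟨0, hm₂⟩)
  suffices H : ∀ q : EuclideanSpace ℝ (Fin m₁) × EuclideanSpace ℝ (Fin m₂),
      ∃ x, ‖q.1‖ < r₁ → ‖q.2‖ < r₂ → ‖x‖ ≤ r₀ ∧ f (x, q.1, q.2) = 0 by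
    choose g hg using H
    exact ⟨g, fun x₁ x₂ => hg (x₁, x₂)⟩
  rintro ⟨x₁, x₂⟩
  by_cases hx : ‖x₁‖ < r₁ ∧ ‖x₂‖ < r₂
  swap
  · exact ⟨0, fun h₁ h₂ => absurd ⟨h₁, h₂⟩ hx⟩
  obtain ⟨hx₁, hx₂⟩ := hx
  have hLn := norm_nonneg L
  have hfd : Differentiable ℝ f := hf.differentiable two_ne_zero
  set σ₀ : ℝ := ‖L‖ * (m₀ * B₀) with hσ₀
  set κ : ℝ := ‖L‖ * (m₁ * tB₁ * ‖x₁‖ + m₂ * tB₂ * ‖x₂‖) with hκdef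
  have hσ₀0 : 0 ≤ σ₀ := by positivity
  have hκ0 : 0 ≤ κ := by positivity
  have hκr : κ < (1 - σ₀ * r₀) * r₀ := by
    set S := ‖L‖ * (m₀ * B₀ * r₀ + m₁ * B₁ * r₁ + m₂ * B₂ * r₂) with hSdef
    have hSσ : σ₀ * r₀ ≤ S := by
      have : 0 ≤ ‖L‖ * (m₁ * B₁ * r₁ + m₂ * B₂ * r₂) := by positivity
      rw [hSdef, hσ₀]
      linarith
    obtain ⟨θ, hθ0, hθ1, hθx₁, hθx₂⟩ : ∃ θ : ℝ, 0 ≤ θ ∧ θ < 1 ∧ ‖x₁‖ ≤ θ * r₁ ∧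
        ‖x₂‖ ≤ θ * r₂ := by
      refine ⟨max (‖x₁‖ / r₁) (‖x₂‖ / r₂), le_max_of_le_left (by positivity),
        max_lt ((div_lt_one hr₁).2 hx₁) ((div_lt_one hr₂).2 hx₂), ?_, ?_⟩
      · exact (div_le_iff₀ hr₁).1 (le_max_left _ _)
      · exact (div_le_iff₀ hr₂).1 (le_max_right _ _)
    have h1 : κ ≤ θ * (‖L‖ * (m₁ * tB₁ * r₁ + m₂ * tB₂ * r₂)) := by
      calc κ ≤ ‖L‖ * (m₁ * tB₁ * (θ * r₁) + m₂ * tB₂ * (θ * r₂)) := by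
            rw [hκdef]; gcongr
        _ = _ := by ring
    have h2 : ‖L‖ * (m₁ * tB₁ * r₁ + m₂ * tB₂ * r₂) ≤ (1 - S) * r₀ := by linarith
    have h3 : 0 < (1 - S) * r₀ := mul_pos (by linarith) hr₀
    have h4 : θ * (‖L‖ * (m₁ * tB₁ * r₁ + m₂ * tB₂ * r₂)) ≤ θ * ((1 - S) * r₀) :=
      mul_le_mul_of_nonneg_left h2 hθ0
    have h5 : (1 - S) * r₀ ≤ (1 - σ₀ * r₀) * r₀ := by gcongr
    have h6 : θ * ((1 - S) * r₀) < (1 - S) * r₀ := mul_lt_of_lt_one_left h3 hθ1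
    linarith
  -- A slightly larger constant is positive.
  obtain ⟨σ, hσ, hσ₀σ, hκσ⟩ : ∃ σ : ℝ, 0 < σ ∧ σ₀ ≤ σ ∧ κ < (1 - σ * r₀) * r₀ := by
    set d := (1 - σ₀ * r₀) * r₀ - κ with hd
    have hd0 : 0 < d := by linarith
    have h : 0 < d / (2 * r₀ ^ 2) := by positivity
    have h' : d / (2 * r₀ ^ 2) * r₀ * r₀ = d / 2 := by field_simp
    exact ⟨σ₀ + d / (2 * r₀ ^ 2), by linarith, by linarith, by nlinarith⟩
  set F : ℝ × EuclideanSpace ℝ (Fin m₀) → EuclideanSpace ℝ (Fin m₀) :=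
    fun p => p.2 - L (f (p.2, p.1 • x₁, p.1 • x₂)) with hFdef
  have hF : ContDiff ℝ 1 F :=
    contDiff_snd.sub (L.contDiff.comp ((hf.of_le one_le_two).comp (by fun_prop)))
  have hFx : ∀ t x, HasFDerivAt (fun y => F (t, y)) ((fderiv ℝ F (t, x)).comp
      (ContinuousLinearMap.inr ℝ ℝ (EuclideanSpace ℝ (Fin m₀)))) x := fun t x =>
    (hF.differentiable one_ne_zero (t, x)).hasFDerivAt.comp x (hasFDerivAt_prodMk_right t x)
  have hF' : ∀ t x v, fderiv ℝ F (t, x) (0, v)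
      = v - L (fderiv ℝ f (x, t • x₁, t • x₂) (v, 0, 0)) := by
    intro t x v
    have h := (hasFDerivAt_id x).sub (L.hasFDerivAt.comp x
      ((hfd (x, t • x₁, t • x₂)).hasFDerivAt.comp x
        (hasFDerivAt_prodMk_left x (t • x₁, t • x₂))))
    exact DFunLike.congr_fun ((hFx t x).unique h) v
  have hT : ∀ t x h, ‖F (t, x + h) - F (t, x) - fderiv ℝ F (t, x) (0, h)‖
      ≤ σ₀ / 2 * ‖h‖ ^ 2 := by
    intro t x h
    refine norm_sub_sub_le_of_lipschitz_fderiv (hFx t) (fun x y v => ?_) x h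
    have h1 := norm_fderiv_sub_le_of_norm_second_partial_le hf hB₀ h2nd₀ (t • x₁, t • x₂) x y v
    calc ‖fderiv ℝ F (t, y) (0, v) - fderiv ℝ F (t, x) (0, v)‖
        = ‖L (fderiv ℝ f (y, t • x₁, t • x₂) (v, 0, 0)
            - fderiv ℝ f (x, t • x₁, t • x₂) (v, 0, 0))‖ := by
          rw [hF', hF', sub_sub_sub_cancel_left, map_sub, norm_sub_rev]
      _ ≤ ‖L‖ * (m₀ * B₀ * ‖y - x‖ * ‖v‖) := L.le_opNorm_of_le h1
      _ = σ₀ * ‖y - x‖ * ‖v‖ := by ring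
  have hF00 : F (0, 0) = 0 := by simpa [hFdef] using congrArg L hf0
  have hF0 : ∀ x, ‖F (0, x)‖ ≤ σ₀ / 2 * ‖x‖ ^ 2 := by
    intro x
    have h := hT 0 0 x
    have h' : fderiv ℝ F (0, 0) (0, x) = 0 := by
      rw [hF', zero_smul, zero_smul, hL1, sub_self]
    rwa [zero_add, hF00, h', sub_zero, sub_zero] at h
  have hdiff := norm_sub_le_of_norm_partial_le hfd htB₁ htB₂ h1st₁ h1st₂
  have hb : ∀ t ∈ Icc (0 : ℝ) 1, ∀ x, ‖F (t, x)‖ ≤ κ + σ₀ / 2 * ‖x‖ ^ 2 := by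
    intro t ht x
    have hle : ∀ {m : ℕ} (y : EuclideanSpace ℝ (Fin m)), ‖t • y‖ ≤ ‖y‖ := fun y => by
      rw [norm_smul, Real.norm_of_nonneg ht.1]
      exact mul_le_of_le_one_left (norm_nonneg y) ht.2
    have h1 : ‖F (t, x) - F (0, x)‖ ≤ κ := by
      have : F (t, x) - F (0, x) = -L (f (x, t • x₁, t • x₂) - f (x, 0, 0)) := by
        simp only [hFdef, zero_smul, map_sub]
        abel
      rw [this, norm_neg]
      refine L.le_opNorm_of_le ((hdiff x _ _).trans ?_)
      gcongr
      · exact hle x₁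
      · exact hle x₂
    calc ‖F (t, x)‖ ≤ ‖F (t, x) - F (0, x)‖ + ‖F (0, x)‖ := by
          simpa using norm_add_le (F (t, x) - F (0, x)) (F (0, x))
      _ ≤ _ := add_le_add h1 (hF0 x)
  have hmono : ∀ v : EuclideanSpace ℝ (Fin m₀), σ₀ / 2 * ‖v‖ ^ 2 ≤ σ / 2 * ‖v‖ ^ 2 :=
    fun v => by gcongr
  obtain ⟨x, hxr, hFix⟩ := exists_isFixedPt_of_homotopy hF hσ hκ0 hr₀ hκσ
    (fun t x h => (hT t x h).trans (hmono h))
    (fun t ht x => (hb t ht x).trans (add_le_add_right (hmono x) κ)) hF00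
  refine ⟨x, fun _ _ => ⟨hxr, ?_⟩⟩
  have hLf : L (f (x, x₁, x₂)) = 0 := by simpa [hFdef] using hFix
  rw [← hL2 (f (x, x₁, x₂)), hLf]
  exact map_zero _
end

section
/- Let $m\ge 1$, $M\ge 0$, and let $f:\mathbb{R}^m\to\mathbb{R}$ be an $M$-Lipschitz function. Let $W,\rho,r>0$ and let $p_1,\dots,p_N\in\mathbb{R}\times\mathbb{R}^m$ be points whose pairwise Euclidean distances are at least $2r$ and such that each $p_j=(t_j,y_j)$ satisfies $|t_j-f(y_j)|<W$ and $\|y_j\|\le\rho$. Then $N\,\omega_{m+1}\,r^{m+1}\;\le\;2\big(W+(1+M)r\big)\,\omega_m\,(\rho+r)^m$, where $\omega_d$ denotes the Lebesgue measure of the unit ball in $\mathbb{R}^d$. -/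
open MeasureTheory

/-- The Lebesgue volume of the unit ball in `ℝ^d`. -/
noncomputable def unitBallVol (d : ℕ) : ℝ :=
  (volume (Metric.ball (0 : EuclideanSpace ℝ (Fin d)) 1)).toReal

/-- In any `d`-dimensional real inner product space, a ball of radius `r` has volume
`r ^ d * unitBallVol d`. -/
theorem volume_ball_eq_unitBallVol {V : Type*} [NormedAddCommGroup V] [InnerProductSpace ℝ V]
    [FiniteDimensional ℝ V] [MeasurableSpace V] [BorelSpace V] {d : ℕ}
    (hd : Module.finrank ℝ V = d) (x : V) {r : ℝ} (hr : 0 < r) :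
    (volume (Metric.ball x r)).toReal = r ^ d * unitBallVol d := by
  let e : V ≃ₗᵢ[ℝ] EuclideanSpace ℝ (Fin d) :=
    ((stdOrthonormalBasis ℝ V).reindex (finCongr hd)).repr
  have he : volume (Metric.ball (0 : V) 1) =
      volume (Metric.ball (0 : EuclideanSpace ℝ (Fin d)) 1) := by
    rw [← e.measurePreserving.measure_preimage measurableSet_ball.nullMeasurableSet,
      e.preimage_ball, map_zero]
  rw [Measure.addHaar_ball_of_pos volume x hr, ENNReal.toReal_mul,
    ENNReal.toReal_ofReal (by positivity), he, hd, unitBallVol]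

/-- The slab of half-height `h` around the graph of a measurable function over a measurable set
`s` has volume `2 * h` times the measure of `s`. -/
theorem volume_regionBetween_sub_add {α : Type*} [MeasurableSpace α] (μ : Measure α) [SFinite μ]
    {f : α → ℝ} (hf : Measurable f) {s : Set α} (hs : MeasurableSet s) (h : ℝ) :
    (μ.prod volume) (regionBetween (fun x => f x - h) (fun x => f x + h) s) =
      ENNReal.ofReal (2 * h) * μ s := by
  rw [volume_regionBetween_eq_lintegral' (hf.sub_const h) (hf.add_const h) hs]
  have : ∀ x, ((fun x => f x + h) - fun x => f x - h) x = 2 * h := fun x => by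
    simp only [Pi.sub_apply]; ring
  simp [this]

/-- Packing estimate used in the proof of Proposition 2.2: if `N` points
`(tⱼ, yⱼ) ∈ ℝ × ℝᵐ` are pairwise `2r`-separated in the Euclidean metric, lie at
vertical distance `< W` from the graph of an `M`-Lipschitz function `f`, and satisfy
`‖yⱼ‖ ≤ ρ`, then `N ω_{m+1} r^{m+1} ≤ 2 (W + (1+M) r) ω_m (ρ+r)^m`. -/
theorem lipschitz_graph_packing (m : ℕ) (hm : 1 ≤ m) (M : ℝ) (hM : 0 ≤ M)
    (f : EuclideanSpace ℝ (Fin m) → ℝ)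
    (hf : ∀ y y', |f y - f y'| ≤ M * ‖y - y'‖)
    (W ρ r : ℝ) (hW : 0 < W) (hρ : 0 < ρ) (hr : 0 < r)
    (N : ℕ) (t : Fin N → ℝ) (y : Fin N → EuclideanSpace ℝ (Fin m))
    (hsep : ∀ i j, i ≠ j → (2 * r) ^ 2 ≤ (t i - t j) ^ 2 + ‖y i - y j‖ ^ 2)
    (hgraph : ∀ j, |t j - f (y j)| < W)
    (hball : ∀ j, ‖y j‖ ≤ ρ) :
    N * unitBallVol (m + 1) * r ^ (m + 1) ≤
      2 * (W + (1 + M) * r) * unitBallVol m * (ρ + r) ^ m := by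
  let V := WithLp 2 (EuclideanSpace ℝ (Fin m) × ℝ)
  set h := W + (1 + M) * r with h_def
  have hh0 : 0 ≤ h := by positivity
  have hfc : Continuous f := by
    refine (LipschitzWith.of_dist_le_mul (K := ⟨M, hM⟩) fun x x' => ?_).continuous
    rw [Real.dist_eq, dist_eq_norm]
    exact hf x x'
  let p : Fin N → V := fun j => WithLp.toLp 2 (y j, t j)
  have hdist : ∀ u v : V, dist u v ^ 2 = ‖u.fst - v.fst‖ ^ 2 + (u.snd - v.snd) ^ 2 := fun u v => by
    rw [dist_eq_norm, WithLp.prod_norm_sq_eq_of_L2, Real.norm_eq_abs, sq_abs]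
    rfl
  have hdisj : Pairwise (Function.onFun Disjoint fun j => Metric.ball (p j) r) := fun i j hij => by
    refine Metric.ball_disjoint_ball ?_
    have h1 : (2 * r) ^ 2 ≤ dist (p i) (p j) ^ 2 := by
      rw [hdist]
      simpa [p, add_comm] using hsep i j hij
    have := (sq_le_sq₀ (by positivity) dist_nonneg).1 h1
    linarith
  let S : Set (EuclideanSpace ℝ (Fin m) × ℝ) :=
    regionBetween (fun x => f x - h) (fun x => f x + h) (Metric.ball 0 (ρ + r))
  have hSmeas : MeasurableSet S :=
    measurableSet_regionBetween (hfc.measurable.sub_const h) (hfc.measurable.add_const h)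
      measurableSet_ball
  have hsub : (⋃ j, Metric.ball (p j) r) ⊆ (WithLp.ofLp : V → _) ⁻¹' S := by
    refine Set.iUnion_subset fun j u hu => ?_
    have hu' := hdist u (p j)
    have hlt : dist u (p j) ^ 2 < r ^ 2 := pow_lt_pow_left₀ hu dist_nonneg two_ne_zero
    have h1 : ‖u.fst - y j‖ < r := by
      refine lt_of_pow_lt_pow_left₀ 2 hr.le ?_
      have := sq_nonneg (u.snd - (p j).snd)
      change dist u (p j) ^ 2 = ‖u.fst - y j‖ ^ 2 + _ at hu'
      linarith
    have h2 : |u.snd - t j| < r := by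
      refine abs_lt_of_sq_lt_sq ?_ hr.le
      have := sq_nonneg ‖u.fst - (p j).fst‖
      change dist u (p j) ^ 2 = _ + (u.snd - t j) ^ 2 at hu'
      linarith
    have h3 : ‖u.fst‖ < ρ + r := by
      have := norm_le_norm_sub_add u.fst (y j)
      linarith [hball j]
    have h4 : |f (y j) - f u.fst| ≤ M * r := by
      refine (hf _ _).trans ?_
      rw [norm_sub_rev]
      exact mul_le_mul_of_nonneg_left h1.le hM
    have h5 := abs_lt.1 (hgraph j)
    rw [abs_lt] at h2
    rw [abs_le] at h4
    refine ⟨by simpa using h3, ?_, ?_⟩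
    · change f u.fst - h < u.snd
      linarith
    · change u.snd < f u.fst + h
      linarith
  have hvolS : volume ((WithLp.ofLp : V → _) ⁻¹' S) =
      ENNReal.ofReal (2 * h) * volume (Metric.ball (0 : EuclideanSpace ℝ (Fin m)) (ρ + r)) := by
    rw [(WithLp.volume_preserving_ofLp _ _).measure_preimage hSmeas.nullMeasurableSet]
    exact volume_regionBetween_sub_add volume hfc.measurable measurableSet_ball h
  have hle := measure_mono (μ := volume) hsub
  rw [measure_iUnion hdisj fun _ => measurableSet_ball, tsum_fintype, hvolS] at hle
  have hreal := ENNReal.toReal_mono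
    (ENNReal.mul_ne_top ENNReal.ofReal_ne_top measure_ball_lt_top.ne) hle
  have hfin : Module.finrank ℝ V = m + 1 := by
    rw [(WithLp.linearEquiv 2 ℝ (EuclideanSpace ℝ (Fin m) × ℝ)).finrank_eq]
    simp
  rw [ENNReal.toReal_sum fun _ _ => measure_ball_lt_top.ne, ENNReal.toReal_mul,
    ENNReal.toReal_ofReal (by positivity),
    volume_ball_eq_unitBallVol finrank_euclideanSpace_fin 0 (by positivity)] at hreal
  simp only [volume_ball_eq_unitBallVol hfin _ hr, Finset.sum_const, Finset.card_univ,
    Fintype.card_fin, nsmul_eq_mul] at hreal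
  linarith
end

section
/- Let $X$ be a real normed vector space, let $\pi_+,\pi_-:X\to X$ be linear maps, and let $c>0$ be such that $c\,(\|\pi_+x\|+\|\pi_-x\|)\le\|x\|$ for all $x\in X$. Let $0<\varepsilon\le\tfrac12$ and suppose $u,v\in X$ satisfy $\|\pi_-u\|\ge 4\varepsilon\,\|\pi_+u\|$ and $\|\pi_-v\|\le 2\varepsilon\,\|\pi_+v\|$. Then $\|u+v\|\ge c\,\varepsilon\,\|\pi_+u\|$. -/
/-- Abstract transversality inequality from the proof of Lemma 5.3: if
`c (‖π₊x‖ + ‖π₋x‖) ≤ ‖x‖` for all `x`, `0 < ε ≤ 1/2`, `u` makes angle at least `4ε`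
with the `π₊` direction (`‖π₋u‖ ≥ 4ε ‖π₊u‖`) and `v` makes angle at most `2ε`
(`‖π₋v‖ ≤ 2ε ‖π₊v‖`), then `‖u + v‖ ≥ c ε ‖π₊u‖`. -/
theorem transversality_lower_bound {X : Type*} [NormedAddCommGroup X]
    [NormedSpace ℝ X] (πp πm : X →ₗ[ℝ] X) (c : ℝ) (hc : 0 < c)
    (hnorm : ∀ x : X, c * (‖πp x‖ + ‖πm x‖) ≤ ‖x‖)
    (ε : ℝ) (hε0 : 0 < ε) (hε : ε ≤ 1 / 2)
    (u v : X)
    (hu : 4 * ε * ‖πp u‖ ≤ ‖πm u‖)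
    (hv : ‖πm v‖ ≤ 2 * ε * ‖πp v‖) :
    c * ε * ‖πp u‖ ≤ ‖u + v‖ := by
  have hp : ‖πp v‖ - ‖πp u‖ ≤ ‖πp (u + v)‖ := by
    have h := norm_sub_le (πp u + πp v) (πp u)
    rw [add_sub_cancel_left] at h
    rw [map_add]
    linarith
  have hm : ‖πm u‖ - ‖πm v‖ ≤ ‖πm (u + v)‖ := by
    have h := norm_sub_le (πm u + πm v) (πm v)
    rw [add_sub_cancel_right] at h
    rw [map_add]
    linarith
  have hscale : 2 * ε * (‖πp v‖ - ‖πp u‖) ≤ ‖πp (u + v)‖ :=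
    (mul_le_mul_of_nonneg_left hp (by positivity)).trans
      (mul_le_of_le_one_left (norm_nonneg _) (by linarith))
  have hsum : ε * ‖πp u‖ ≤ ‖πp (u + v)‖ + ‖πm (u + v)‖ := by
    have h : 0 ≤ ε * ‖πp u‖ := by positivity
    linarith
  calc c * ε * ‖πp u‖ = c * (ε * ‖πp u‖) := mul_assoc _ _ _
    _ ≤ c * (‖πp (u + v)‖ + ‖πm (u + v)‖) := mul_le_mul_of_nonneg_left hsum hc.le
    _ ≤ ‖u + v‖ := hnorm _
end
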